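/- Let F : C → D be a monoidal functor between rigid monoidal categories with right adjoint R. Then R(F(X)) ≅ X ⊗ R(1) for every object X of C, where 1 is the unit object of D. -/

import Mathlib

open CategoryTheory MonoidalCategory

open Functor.LaxMonoidal Functor.OplaxMonoidal in
/-- A monoidal functor sends exact pairings to exact pairings. -/
abbrev CategoryTheory.Functor.mapExactPairing {C D : Type*} [Category C] [Category D]
    [MonoidalCategory C] [MonoidalCategory D] (F : C ⥤ D) [F.Monoidal]
    (X Y : C) [ExactPairing X Y] : ExactPairing (F.obj X) (F.obj Y) where
  coevaluation' := ε F ≫ F.map (η_ X Y) ≫ δ F X Y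
  evaluation' := μ F Y X ≫ F.map (ε_ X Y) ≫ η F
  coevaluation_evaluation' := by
    calc
      _ = F.obj Y ◁ ε F ≫ μ F Y (𝟙_ C) ≫
          F.map (Y ◁ η_ X Y ≫ (α_ Y X Y).inv ≫ ε_ X Y ▷ Y) ≫
          δ F (𝟙_ C) Y ≫ η F ▷ F.obj Y := by
        simp only [Functor.map_comp, Functor.Monoidal.map_associator_inv,
          Functor.Monoidal.map_whiskerLeft, Functor.Monoidal.map_whiskerRight,
          Category.assoc, comp_whiskerRight, MonoidalCategory.whiskerLeft_comp,
          Functor.Monoidal.μ_δ_assoc]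
      _ = _ := by
        rw [ExactPairing.coevaluation_evaluation]
        simp
  evaluation_coevaluation' := by
    calc
      _ = ε F ▷ F.obj X ≫ μ F (𝟙_ C) X ≫
          F.map (η_ X Y ▷ X ≫ (α_ X Y X).hom ≫ X ◁ ε_ X Y) ≫
          δ F X (𝟙_ C) ≫ F.obj X ◁ η F := by
        simp only [Functor.map_comp, Functor.Monoidal.map_associator,
          Functor.Monoidal.map_whiskerLeft, Functor.Monoidal.map_whiskerRight,
          Category.assoc, comp_whiskerRight, MonoidalCategory.whiskerLeft_comp,
          Functor.Monoidal.μ_δ_assoc]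
      _ = _ := by
        rw [ExactPairing.evaluation_coevaluation]
        simp

/-- If `F : C ⥤ D` is a monoidal functor between rigid monoidal categories with right
adjoint `R`, then `R(F(X)) ≅ X ⊗ R(1)` for every object `X` of `C`, where `1` is the
unit object of `D`. -/
theorem right_adjoint_comp_iso {C D : Type*} [Category C] [Category D]
    [MonoidalCategory C] [MonoidalCategory D] [RigidCategory C] [RigidCategory D]
    (F : C ⥤ D) [F.Monoidal] (R : D ⥤ C) (adj : F ⊣ R)
    (X : C) :
    Nonempty (R.obj (F.obj X) ≅ X ⊗ R.obj (𝟙_ D)) := by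
  let := F.mapExactPairing X Xᘁ
  let adj₁ := adj.comp (tensorLeftAdjunction (F.obj X) (F.obj Xᘁ))
  let adj₂ := (tensorLeftAdjunction X Xᘁ).comp adj
  let i := conjugateIsoEquiv adj₁ adj₂ (Functor.Monoidal.commTensorLeft F Xᘁ).symm
  exact ⟨R.mapIso (ρ_ (F.obj X)).symm ≪≫ i.app (𝟙_ D)⟩
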